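/- Let θ ∈ (0, π/2), λ ≥ 2, and suppose π is an invariant probability measure for the chain δ_{t+1} = δ_t − X_δ cos θ − Y_δ sin θ with (X_δ,Y_δ) ~ p*_δ, with δ ↦ E_δ[|X_δ|] + E_δ[|Y_δ|] π-integrable. Then ∫ E_δ[X_δ] π(dδ) > 0. -/

import Mathlib

open MeasureTheory ProbabilityTheory Real Set Filter

noncomputable def phi (x : ℝ) : ℝ := Real.exp (-x^2/2) / Real.sqrt (2*Real.pi)
noncomputable def Phi (x : ℝ) : ℝ := ∫ u in Set.Iic x, phi u
noncomputable def pdelta (θ δ : ℝ) (z : ℝ × ℝ) : ℝ :=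
  phi z.1 * phi z.2 * Set.indicator (Set.Ici (0:ℝ)) (fun _ => 1)
    (δ - z.1 * Real.cos θ - z.2 * Real.sin θ) / Phi δ
noncomputable def p1 (θ δ x : ℝ) : ℝ :=
  phi x * Phi ((δ - x * Real.cos θ) / Real.sin θ) / Phi δ
noncomputable def F1 (θ δ x : ℝ) : ℝ := ∫ u in Set.Iic x, p1 θ δ u
noncomputable def pstar (lam : ℕ) (θ δ : ℝ) (z : ℝ × ℝ) : ℝ :=
  (lam : ℝ) * pdelta θ δ z * F1 θ δ z.1 ^ (lam - 1)
noncomputable def p1star (lam : ℕ) (θ δ x : ℝ) : ℝ :=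
  (lam : ℝ) * p1 θ δ x * F1 θ δ x ^ (lam - 1)
noncomputable def p2star (lam : ℕ) (θ δ y : ℝ) : ℝ :=
  (lam : ℝ) * (phi y / Phi δ) *
    ∫ u in Set.Iic ((δ - y * Real.sin θ) / Real.cos θ), phi u * F1 θ δ u ^ (lam - 1)

noncomputable def transKer (lam : ℕ) (θ δ : ℝ) : Measure ℝ :=
  Measure.map (fun z : ℝ × ℝ => δ - z.1 * Real.cos θ - z.2 * Real.sin θ)
    (volume.withDensity (fun z => ENNReal.ofReal (pstar lam θ δ z)))

open scoped MeasureTheory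
lemma phi_eq : phi = gaussianPDFReal 0 1 := by
  funext x
  simp [phi, gaussianPDFReal, div_eq_inv_mul]

lemma phi_pos (x : ℝ) : 0 < phi x := by
  unfold phi; positivity

lemma phi_cont : Continuous phi := by
  unfold phi; fun_prop

lemma phi_int : Integrable phi := by
  rw [phi_eq]; exact integrable_gaussianPDFReal 0 1

lemma phi_integral : ∫ x, phi x = 1 := by
  rw [phi_eq]; exact integral_gaussianPDFReal_eq_one 0 one_ne_zero

lemma hasDerivAt_Iic_int (f : ℝ → ℝ) (hf : Continuous f) (hi : Integrable f) (x : ℝ) :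
    HasDerivAt (fun t => ∫ u in Set.Iic t, f u) (f x) x := by
  have h : (fun t => ∫ u in Set.Iic t, f u)
      = fun t => (∫ u in Set.Iic (0:ℝ), f u) + ∫ u in (0:ℝ)..t, f u := by
    funext t
    rw [← intervalIntegral.integral_Iic_sub_Iic hi.integrableOn hi.integrableOn]
    ring
  rw [h]
  exact (hf.integral_hasStrictDerivAt 0 x).hasDerivAt.const_add _

lemma Iic_int_tendsto_top (f : ℝ → ℝ) (hi : Integrable f) :
    Tendsto (fun t => ∫ u in Set.Iic t, f u) atTop (nhds (∫ u, f u)) :=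
  (aecover_Iic tendsto_id).integral_tendsto_of_countably_generated hi

lemma Iic_int_tendsto_bot (f : ℝ → ℝ) :
    Tendsto (fun t => ∫ u in Set.Iic t, f u) atBot (nhds 0) :=
  tendsto_integral_Iic_zero tendsto_id

lemma Iic_int_pos (f : ℝ → ℝ) (hp : ∀ x, 0 < f x) (hi : Integrable f) (x : ℝ) :
    0 < ∫ u in Set.Iic x, f u := by
  rw [setIntegral_pos_iff_support_of_nonneg_ae (Eventually.of_forall fun x => (hp x).le)
    hi.integrableOn]
  have : Function.support f = Set.univ := by
    ext x; simp [(hp x).ne']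
  simp [this]

lemma Phi_cont : Continuous Phi :=
  continuous_iff_continuousAt.2 fun x => (hasDerivAt_Iic_int phi phi_cont phi_int x).continuousAt

lemma Phi_pos (x : ℝ) : 0 < Phi x := Iic_int_pos phi phi_pos phi_int x

lemma Phi_le_one (x : ℝ) : Phi x ≤ 1 := by
  rw [← phi_integral]
  exact setIntegral_le_integral phi_int (Eventually.of_forall fun x => (phi_pos x).le)

lemma Phi_eq (x : ℝ) : ENNReal.ofReal (Phi x) = gaussianReal 0 1 (Set.Iic x) := by
  rw [gaussianReal_apply_eq_integral 0 one_ne_zero, Phi, phi_eq]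

lemma rot_aux (θ δ : ℝ) (hs : 0 < Real.sin θ) :
    ∫⁻ x, gaussianReal 0 1 (Set.Iic ((δ - x * Real.cos θ) / Real.sin θ)) ∂(gaussianReal 0 1)
      = gaussianReal 0 1 (Set.Iic δ) := by
  have hconv : ((gaussianReal 0 1).map (Real.cos θ * ·)) ∗ ((gaussianReal 0 1).map (Real.sin θ * ·))
      = gaussianReal 0 1 := by
    rw [gaussianReal_map_const_mul, gaussianReal_map_const_mul, gaussianReal_conv_gaussianReal]
    congr 1
    · simp
    · ext; simp
  conv_rhs => rw [← hconv]
  rw [Measure.conv, Measure.map_apply (by fun_prop) measurableSet_Iic,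
    Measure.map_prod_map _ _ (by fun_prop) (by fun_prop), 
    Measure.map_apply (by fun_prop) (measurableSet_Iic.preimage (by fun_prop)),
    Measure.prod_apply]
  · congr 1; funext x; congr 1; ext y
    simp only [Set.mem_Iic, Set.mem_preimage, Prod.map]
    rw [le_div_iff₀ hs]
    constructor <;> intro h <;> nlinarith
  · exact (measurableSet_Iic.preimage (by fun_prop)).preimage (by fun_prop)

lemma rot (θ δ : ℝ) (hs : 0 < Real.sin θ) :
    ∫ x, phi x * Phi ((δ - x * Real.cos θ) / Real.sin θ) = Phi δ := by
  have h := rot_aux θ δ hs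
  simp_rw [← Phi_eq] at h
  have e : ∫ x, Phi ((δ - x * Real.cos θ) / Real.sin θ) ∂(gaussianReal 0 1)
     = ∫ x, phi x * Phi ((δ - x * Real.cos θ) / Real.sin θ) := by
    rw [integral_gaussianReal_eq_integral_smul one_ne_zero, phi_eq]; rfl
  rw [← e, integral_eq_lintegral_of_nonneg_ae (Eventually.of_forall fun x => (Phi_pos _).le)
    (Phi_cont.comp (by fun_prop)).aestronglyMeasurable, h, ENNReal.toReal_ofReal (Phi_pos _).le]

lemma p1_pos (θ δ x : ℝ) : 0 < p1 θ δ x :=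
  div_pos (mul_pos (phi_pos _) (Phi_pos _)) (Phi_pos _)

lemma p1_cont (θ δ : ℝ) : Continuous (p1 θ δ) := by
  unfold p1
  exact (phi_cont.mul (Phi_cont.comp (by fun_prop))).div_const _

lemma p1_int (θ δ : ℝ) : Integrable (p1 θ δ) := by
  refine (phi_int.div_const (Phi δ)).mono' (p1_cont θ δ).aestronglyMeasurable
    (Eventually.of_forall fun x => ?_)
  rw [Real.norm_of_nonneg (p1_pos _ _ _).le, p1]
  have := phi_pos x
  have := Phi_pos δ
  gcongr
  exact mul_le_of_le_one_right (phi_pos x).le (Phi_le_one _)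

lemma p1_integral (θ δ : ℝ) (hs : 0 < Real.sin θ) : ∫ x, p1 θ δ x = 1 := by
  unfold p1
  rw [integral_div, rot θ δ hs, div_self (Phi_pos δ).ne']

lemma F1_pos (θ δ x : ℝ) : 0 < F1 θ δ x :=
  Iic_int_pos _ (p1_pos θ δ) (p1_int θ δ) x

lemma F1_le_one (θ δ x : ℝ) (hs : 0 < Real.sin θ) : F1 θ δ x ≤ 1 := by
  rw [← p1_integral θ δ hs]
  exact setIntegral_le_integral (p1_int θ δ) (Eventually.of_forall fun x => (p1_pos _ _ x).le)

lemma F1_deriv (θ δ x : ℝ) : HasDerivAt (F1 θ δ) (p1 θ δ x) x :=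
  hasDerivAt_Iic_int _ (p1_cont θ δ) (p1_int θ δ) x

lemma F1_cont (θ δ : ℝ) : Continuous (F1 θ δ) :=
  continuous_iff_continuousAt.2 fun x => (F1_deriv θ δ x).continuousAt

lemma p1star_integral (lam : ℕ) (hlam : 2 ≤ lam) (θ δ : ℝ) (hs : 0 < Real.sin θ) :
    ∫ x, p1star lam θ δ x = 1 := by
  have hd : ∀ x, HasDerivAt (fun x => F1 θ δ x ^ lam) (p1star lam θ δ x) x := by
    intro x
    refine ((F1_deriv θ δ x).pow lam).congr_deriv ?_
    unfold p1star; ring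
  have hi : Integrable (p1star lam θ δ) := by
    refine ((p1_int θ δ).const_mul (lam:ℝ)).mono' ?_ (Eventually.of_forall fun x => ?_)
    · exact ((continuous_const.mul (p1_cont θ δ)).mul
        ((F1_cont θ δ).pow _)).aestronglyMeasurable
    · have h1 := p1_pos θ δ x
      have h2 := F1_pos θ δ x
      rw [Real.norm_of_nonneg (by unfold p1star; positivity), p1star]
      exact mul_le_of_le_one_right (by positivity) (pow_le_one₀ h2.le (F1_le_one θ δ x hs))
  have hb : Tendsto (fun x => F1 θ δ x ^ lam) atBot (nhds 0) := by
    have := (Iic_int_tendsto_bot (p1 θ δ)).pow lam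
    rwa [zero_pow (by omega)] at this
  have ht : Tendsto (fun x => F1 θ δ x ^ lam) atTop (nhds 1) := by
    have := (Iic_int_tendsto_top (p1 θ δ) (p1_int θ δ)).pow lam
    rwa [p1_integral θ δ hs, one_pow] at this
  rw [integral_of_hasDerivAt_of_tendsto hd hi hb ht, sub_zero]

lemma phi_deriv (x : ℝ) : HasDerivAt phi (-(x * phi x)) x := by
  have h1 : HasDerivAt (fun x : ℝ => -x^2/2) (-x) x := by
    refine ((hasDerivAt_pow 2 x).neg.div_const 2).congr_deriv ?_
    norm_num
    ring
  refine (h1.exp.div_const (Real.sqrt (2*Real.pi))).congr_deriv ?_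
  unfold phi; ring

lemma x_phi_int : Integrable (fun x => x * phi x) := by
  have := (integrable_mul_exp_neg_mul_sq (b := 1/2) (by norm_num)).div_const (Real.sqrt (2*Real.pi))
  refine this.congr (Eventually.of_forall fun x => ?_)
  simp only [phi]
  rw [show -(1/2) * x^2 = -x^2/2 by ring]; ring

lemma phi_bot : Tendsto phi atBot (nhds 0) := by
  have h : Tendsto (fun x:ℝ => -x^2/2) atBot atBot := by
    have h2 : Tendsto (fun x:ℝ => x^2) atBot atTop := by
      refine ((tendsto_pow_atTop (α := ℝ) (n := 2) (by norm_num)).comp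
        tendsto_abs_atBot_atTop).congr fun x => ?_
      simp
    exact (tendsto_neg_atTop_atBot.comp h2).atBot_div_const (by norm_num)
  have := (Real.tendsto_exp_atBot.comp h).div_const (Real.sqrt (2*Real.pi))
  rw [zero_div] at this
  exact this

lemma y_phi_integral (a : ℝ) : ∫ y in Set.Iic a, y * phi y = - phi a := by
  have := integral_Iic_of_hasDerivAt_of_tendsto' (f := fun x => - phi x) (f' := fun x => x * phi x)
    (a := a) (m := 0)
    (fun x _ => (phi_deriv x).neg.congr_deriv (by ring)) x_phi_int.integrableOn (by simpa using phi_bot.neg)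
  simpa using this

lemma F1_meas (θ : ℝ) : Measurable (fun q : ℝ × ℝ => F1 θ q.1 q.2) := by
  have hp : Measurable (fun w : (ℝ × ℝ) × ℝ => p1 θ w.1.1 w.2) := by
    unfold p1
    exact ((phi_cont.measurable.comp (by fun_prop)).mul
      (Phi_cont.measurable.comp (by fun_prop))).div (Phi_cont.measurable.comp (by fun_prop))
  have hm : Measurable (fun w : (ℝ × ℝ) × ℝ =>
      Set.indicator {w : (ℝ × ℝ) × ℝ | w.2 ≤ w.1.2} (fun w => p1 θ w.1.1 w.2) w) :=
    hp.indicator (measurableSet_le (by fun_prop) (by fun_prop))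
  have := (hm.stronglyMeasurable.integral_prod_right' (ν := (volume : Measure ℝ))).measurable
  convert this using 2 with q
  rw [F1, ← integral_indicator measurableSet_Iic]
  rfl

lemma pstar_eq (lam : ℕ) (θ δ : ℝ) (hs : 0 < Real.sin θ) (x y : ℝ) :
    pstar lam θ δ (x, y) = (lam * phi x * F1 θ δ x ^ (lam - 1) / Phi δ) *
      Set.indicator (Set.Iic ((δ - x * Real.cos θ) / Real.sin θ)) phi y := by
  unfold pstar pdelta
  by_cases h : y ≤ (δ - x * Real.cos θ) / Real.sin θ
  · have h2 : 0 ≤ δ - x * Real.cos θ - y * Real.sin θ := by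
      rw [le_div_iff₀ hs] at h; linarith
    rw [Set.indicator_of_mem (by exact h2), Set.indicator_of_mem (by exact h)]
    ring
  · have h2 : ¬ 0 ≤ δ - x * Real.cos θ - y * Real.sin θ := by
      rw [le_div_iff₀ hs] at h; intro h3; apply h; linarith
    rw [Set.indicator_of_notMem (by exact h2), Set.indicator_of_notMem (by exact h)]
    ring

lemma pstar_support (lam : ℕ) (θ δ : ℝ) (z : ℝ × ℝ)
    (h : ¬ 0 ≤ δ - z.1 * Real.cos θ - z.2 * Real.sin θ) : pstar lam θ δ z = 0 := by
  unfold pstar pdelta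
  rw [Set.indicator_of_notMem (by exact h)]
  ring

lemma pstar_meas (lam : ℕ) (θ : ℝ) :
    Measurable (fun q : ℝ × (ℝ × ℝ) => pstar lam θ q.1 q.2) := by
  have h1 : Measurable (fun q : ℝ × (ℝ × ℝ) => F1 θ q.1 q.2.1) :=
    (F1_meas θ).comp (g := fun q : ℝ × ℝ => F1 θ q.1 q.2)
      (f := fun q : ℝ × (ℝ × ℝ) => (q.1, q.2.1)) (by fun_prop)
  have h2 : Measurable (fun q : ℝ × (ℝ × ℝ) => Set.indicator (Set.Ici (0:ℝ)) (fun _ => (1:ℝ))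
      (q.1 - q.2.1 * Real.cos θ - q.2.2 * Real.sin θ)) :=
    (measurable_const.indicator measurableSet_Ici).comp (by fun_prop)
  have h3 : Measurable (fun q : ℝ × (ℝ × ℝ) => phi q.2.1) := phi_cont.measurable.comp (by fun_prop)
  have h4 : Measurable (fun q : ℝ × (ℝ × ℝ) => phi q.2.2) := phi_cont.measurable.comp (by fun_prop)
  have h5 : Measurable (fun q : ℝ × (ℝ × ℝ) => Phi q.1) := Phi_cont.measurable.comp (by fun_prop)
  unfold pstar pdelta
  exact (((((h3.mul h4).mul h2).div h5).const_mul _).mul (h1.pow_const _))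

lemma pstar_meas' (lam : ℕ) (θ δ : ℝ) : Measurable (pstar lam θ δ) :=
  (pstar_meas lam θ).comp (g := fun q : ℝ × (ℝ × ℝ) => pstar lam θ q.1 q.2)
    (f := fun z => (δ, z)) (by fun_prop)

lemma pstar_nonneg (lam : ℕ) (θ δ : ℝ) (z : ℝ × ℝ) : 0 ≤ pstar lam θ δ z := by
  unfold pstar pdelta
  have := phi_pos z.1
  have := phi_pos z.2
  have := F1_pos θ δ z.1
  have := Phi_pos δ
  have : 0 ≤ Set.indicator (Set.Ici (0:ℝ)) (fun _ => (1:ℝ))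
    (δ - z.1 * Real.cos θ - z.2 * Real.sin θ) := Set.indicator_nonneg (fun _ _ => zero_le_one) _
  positivity

lemma pstar_le (lam : ℕ) (θ δ : ℝ) (hs : 0 < Real.sin θ) (z : ℝ × ℝ) :
    pstar lam θ δ z ≤ lam / Phi δ * (phi z.1 * phi z.2) := by
  obtain ⟨x, y⟩ := z
  rw [pstar_eq lam θ δ hs]
  have h1 := phi_pos x
  have h2 := phi_pos y
  have h3 := F1_pos θ δ x
  have h4 := Phi_pos δ
  have h5 : Set.indicator (Set.Iic ((δ - x * Real.cos θ) / Real.sin θ)) phi y ≤ phi y :=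
    Set.indicator_le_self' (fun _ _ => h2.le) _
  have h7 : 0 ≤ Set.indicator (Set.Iic ((δ - x * Real.cos θ) / Real.sin θ)) phi y :=
    Set.indicator_nonneg (fun u _ => (phi_pos u).le) _
  have h6 : F1 θ δ x ^ (lam - 1) ≤ 1 := pow_le_one₀ h3.le (F1_le_one θ δ x hs)
  calc _ ≤ (lam * phi x * 1 / Phi δ) * phi y := by gcongr
    _ = _ := by ring

lemma mul_pstar_int (lam : ℕ) (θ δ : ℝ) (hs : 0 < Real.sin θ) (g : ℝ × ℝ → ℝ) (hg : Measurable g)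
    (hi : Integrable (fun z : ℝ × ℝ => g z * (phi z.1 * phi z.2))) :
    Integrable (fun z => g z * pstar lam θ δ z) := by
  refine (hi.norm.const_mul (lam / Phi δ)).mono' (hg.mul (pstar_meas' lam θ δ)).aestronglyMeasurable
    (Eventually.of_forall fun z => ?_)
  have h1 := phi_pos z.1
  have h2 := phi_pos z.2
  rw [norm_mul, norm_mul, Real.norm_of_nonneg (pstar_nonneg _ _ _ _),
    Real.norm_of_nonneg (mul_pos h1 h2).le]
  calc _ ≤ ‖g z‖ * (lam / Phi δ * (phi z.1 * phi z.2)) := by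
        gcongr; exact pstar_le lam θ δ hs z
    _ = _ := by ring

lemma pstar_int (lam : ℕ) (θ δ : ℝ) (hs : 0 < Real.sin θ) : Integrable (pstar lam θ δ) := by
  have := mul_pstar_int lam θ δ hs (fun _ => 1) measurable_const
    (by simp only [one_mul]; exact phi_int.mul_prod phi_int)
  simpa using this

lemma x_pstar_int (lam : ℕ) (θ δ : ℝ) (hs : 0 < Real.sin θ) :
    Integrable (fun z : ℝ × ℝ => z.1 * pstar lam θ δ z) := by
  refine mul_pstar_int lam θ δ hs (fun z => z.1) measurable_fst ?_
  refine (x_phi_int.mul_prod phi_int).congr (Eventually.of_forall fun z => ?_)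
  simp only; ring

lemma y_pstar_int (lam : ℕ) (θ δ : ℝ) (hs : 0 < Real.sin θ) :
    Integrable (fun z : ℝ × ℝ => z.2 * pstar lam θ δ z) := by
  refine mul_pstar_int lam θ δ hs (fun z => z.2) measurable_snd ?_
  refine (phi_int.mul_prod x_phi_int).congr (Eventually.of_forall fun z => ?_)
  simp only; ring

lemma pstar_integral (lam : ℕ) (hlam : 2 ≤ lam) (θ δ : ℝ) (hs : 0 < Real.sin θ) :
    ∫ z, pstar lam θ δ z = 1 := by
  have hi := pstar_int lam θ δ hs
  rw [Measure.volume_eq_prod] at hi ⊢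
  rw [integral_prod _ hi, ← p1star_integral lam hlam θ δ hs]
  congr 1; funext x
  simp_rw [pstar_eq lam θ δ hs]
  rw [integral_const_mul, integral_indicator measurableSet_Iic]
  change _ * Phi _ = _
  unfold p1star p1; ring

lemma y_neg (lam : ℕ) (hlam : 2 ≤ lam) (θ δ : ℝ) (hs : 0 < Real.sin θ) :
    ∫ z : ℝ × ℝ, z.2 * pstar lam θ δ z < 0 := by
  have hi := y_pstar_int lam θ δ hs
  rw [Measure.volume_eq_prod] at hi ⊢
  have he : ∀ x, ∫ y, y * pstar lam θ δ (x, y) =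
      - ((lam * phi x * F1 θ δ x ^ (lam - 1) / Phi δ) *
        phi ((δ - x * Real.cos θ) / Real.sin θ)) := by
    intro x
    rw [← mul_neg, ← y_phi_integral, ← integral_indicator measurableSet_Iic, ← integral_const_mul]
    congr 1; funext y
    rw [pstar_eq lam θ δ hs]
    by_cases h : y ∈ Set.Iic ((δ - x * Real.cos θ) / Real.sin θ)
    · rw [Set.indicator_of_mem h, Set.indicator_of_mem h]; ring
    · rw [Set.indicator_of_notMem h, Set.indicator_of_notMem h]; ring
  have hi2 := hi.integral_prod_left
  rw [integral_prod _ hi]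
  simp only [he] at hi2 ⊢
  rw [integral_neg, neg_lt_zero]
  have hp : ∀ x, 0 < (lam * phi x * F1 θ δ x ^ (lam - 1) / Phi δ) *
        phi ((δ - x * Real.cos θ) / Real.sin θ) := by
    intro x
    have := phi_pos x
    have := F1_pos θ δ x
    have := Phi_pos δ
    have := phi_pos ((δ - x * Real.cos θ) / Real.sin θ)
    have : 0 < lam := by omega
    positivity
  rw [integral_pos_iff_support_of_nonneg (fun x => (hp x).le) (by simpa using hi2.neg)]
  have : (Function.support fun x => (lam * phi x * F1 θ δ x ^ (lam - 1) / Phi δ) *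
        phi ((δ - x * Real.cos θ) / Real.sin θ)) = Set.univ := by
    ext x; simp only [Function.mem_support, Set.mem_univ, iff_true]; exact (hp x).ne'
  rw [this]; simp

lemma transKer_lintegral (lam : ℕ) (θ δ : ℝ) (g : ℝ → ENNReal) (hg : Measurable g) :
    ∫⁻ t, g t ∂(transKer lam θ δ) = ∫⁻ z : ℝ × ℝ, ENNReal.ofReal (pstar lam θ δ z) *
      g (δ - z.1 * Real.cos θ - z.2 * Real.sin θ) := by
  unfold transKer
  rw [lintegral_map hg (by fun_prop),
    lintegral_withDensity_eq_lintegral_mul _ (pstar_meas' lam θ δ).ennreal_ofReal (by fun_prop)]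
  rfl

lemma transKer_meas (lam : ℕ) (θ : ℝ) : Measurable (transKer lam θ) := by
  refine Measure.measurable_of_measurable_coe _ fun A hA => ?_
  have h : ∀ δ, transKer lam θ δ A = ∫⁻ z : ℝ × ℝ, ENNReal.ofReal (pstar lam θ δ z) *
      A.indicator 1 (δ - z.1 * Real.cos θ - z.2 * Real.sin θ) := by
    intro δ
    rw [← transKer_lintegral lam θ δ _ (measurable_one.indicator hA), lintegral_indicator_one hA]
  simp_rw [h]
  refine Measurable.lintegral_prod_right' (f := fun q : ℝ × (ℝ × ℝ) =>
    ENNReal.ofReal (pstar lam θ q.1 q.2) *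
      A.indicator 1 (q.1 - q.2.1 * Real.cos θ - q.2.2 * Real.sin θ)) ?_
  exact (pstar_meas lam θ).ennreal_ofReal.mul
    ((measurable_one.indicator hA).comp (by fun_prop))

lemma int_sub_sub {α : Type*} [MeasurableSpace α] {ν : Measure α} {f g h : α → ℝ}
    (hf : Integrable f ν) (hg : Integrable g ν) (hh : Integrable h ν) :
    Integrable (fun x => f x - g x - h x) ν := (hf.sub hg).sub hh

lemma integral_sub_sub {α : Type*} [MeasurableSpace α] {ν : Measure α} {f g h : α → ℝ}
    (hf : Integrable f ν) (hg : Integrable g ν) (hh : Integrable h ν) :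
    ∫ x, (f x - g x - h x) ∂ν = ∫ x, f x ∂ν - ∫ x, g x ∂ν - ∫ x, h x ∂ν := by
  have hfg : Integrable (fun x => f x - g x) ν := hf.sub hg
  rw [integral_sub hfg hh, integral_sub hf hg]

/-- for λ ≥ 2, if μ is an invariant probability measure of the
chain (supported on ℝ₊) with the required integrability, then the mean selected
step along ∇f is strictly positive: ∫ E_δ[X_δ] dμ > 0. -/
theorem stmt19 (lam : ℕ) (hlam : 2 ≤ lam) (θ : ℝ)
    (hθ : θ ∈ Set.Ioo 0 (Real.pi/2))
    (μ : Measure ℝ) [IsProbabilityMeasure μ]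
    (hsupp : ∀ᵐ δ ∂μ, 0 ≤ δ)
    (hinv : ∀ A : Set ℝ, MeasurableSet A → (∫⁻ δ, transKer lam θ δ A ∂μ) = μ A)
    (hid : Integrable (fun δ => δ) μ)
    (habs : Integrable (fun δ => (∫ z : ℝ × ℝ, |z.1| * pstar lam θ δ z)
      + (∫ z : ℝ × ℝ, |z.2| * pstar lam θ δ z)) μ) :
    0 < ∫ δ, (∫ z : ℝ × ℝ, z.1 * pstar lam θ δ z) ∂μ := by
  obtain ⟨h0, h2⟩ := hθ
  have hs : 0 < Real.sin θ := Real.sin_pos_of_pos_of_lt_pi h0 (by linarith)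
  have hc : 0 < Real.cos θ := Real.cos_pos_of_mem_Ioo ⟨by linarith, h2⟩
  have mX : Measurable (fun δ => ∫ z : ℝ × ℝ, z.1 * pstar lam θ δ z) :=
    (((measurable_fst.comp measurable_snd).mul
      (pstar_meas lam θ)).stronglyMeasurable.integral_prod_right'
        (ν := (volume : Measure (ℝ × ℝ)))).measurable
  have mY : Measurable (fun δ => ∫ z : ℝ × ℝ, z.2 * pstar lam θ δ z) :=
    (((measurable_snd.comp measurable_snd).mul
      (pstar_meas lam θ)).stronglyMeasurable.integral_prod_right'
        (ν := (volume : Measure (ℝ × ℝ)))).measurable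
  have bX : ∀ δ, ‖∫ z : ℝ × ℝ, z.1 * pstar lam θ δ z‖ ≤ ∫ z : ℝ × ℝ, |z.1| * pstar lam θ δ z := by
    intro δ
    refine (norm_integral_le_integral_norm _).trans (le_of_eq ?_)
    congr 1; funext z
    rw [norm_mul, Real.norm_of_nonneg (pstar_nonneg _ _ _ _), Real.norm_eq_abs]
  have bY : ∀ δ, ‖∫ z : ℝ × ℝ, z.2 * pstar lam θ δ z‖ ≤ ∫ z : ℝ × ℝ, |z.2| * pstar lam θ δ z := by
    intro δ
    refine (norm_integral_le_integral_norm _).trans (le_of_eq ?_)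
    congr 1; funext z
    rw [norm_mul, Real.norm_of_nonneg (pstar_nonneg _ _ _ _), Real.norm_eq_abs]
  have iX : Integrable (fun δ => ∫ z : ℝ × ℝ, z.1 * pstar lam θ δ z) μ :=
    habs.mono' mX.aestronglyMeasurable (Eventually.of_forall fun δ => by
      have := bX δ
      have := (norm_nonneg _).trans (bY δ)
      linarith)
  have iY : Integrable (fun δ => ∫ z : ℝ × ℝ, z.2 * pstar lam θ δ z) μ :=
    habs.mono' mY.aestronglyMeasurable (Eventually.of_forall fun δ => by
      have := bY δ
      have := (norm_nonneg _).trans (bX δ)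
      linarith)
  have hbind : μ.bind (transKer lam θ) = μ := by
    ext A hA
    rw [Measure.bind_apply hA (transKer_meas lam θ).aemeasurable, hinv A hA]
  -- the conditional mean of the next state
  have hmean : ∀ δ, ∫ z : ℝ × ℝ, (δ - z.1 * Real.cos θ - z.2 * Real.sin θ) * pstar lam θ δ z =
      δ - (∫ z : ℝ × ℝ, z.1 * pstar lam θ δ z) * Real.cos θ
        - (∫ z : ℝ × ℝ, z.2 * pstar lam θ δ z) * Real.sin θ := by
    intro δ
    have e : (fun z : ℝ × ℝ => (δ - z.1 * Real.cos θ - z.2 * Real.sin θ) * pstar lam θ δ z) =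
        fun z => δ * pstar lam θ δ z - (z.1 * pstar lam θ δ z) * Real.cos θ
          - (z.2 * pstar lam θ δ z) * Real.sin θ := by
      funext z; ring
    have i0 := (pstar_int lam θ δ hs).const_mul δ
    have i1 := (x_pstar_int lam θ δ hs).mul_const (Real.cos θ)
    have i2 := (y_pstar_int lam θ δ hs).mul_const (Real.sin θ)
    rw [e, integral_sub_sub i0 i1 i2, integral_const_mul,
      integral_mul_const, integral_mul_const, pstar_integral lam hlam θ δ hs, mul_one]
  have hint : ∀ δ, Integrable (fun z : ℝ × ℝ =>
      (δ - z.1 * Real.cos θ - z.2 * Real.sin θ) * pstar lam θ δ z) := by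
    intro δ
    have i0 := (pstar_int lam θ δ hs).const_mul δ
    have i1 := (x_pstar_int lam θ δ hs).mul_const (Real.cos θ)
    have i2 := (y_pstar_int lam θ δ hs).mul_const (Real.sin θ)
    refine ((i0.sub i1).sub i2).congr (Eventually.of_forall fun z => ?_)
    simp only [Pi.sub_apply]; ring
  have hnn : ∀ δ (z : ℝ × ℝ),
      0 ≤ (δ - z.1 * Real.cos θ - z.2 * Real.sin θ) * pstar lam θ δ z := by
    intro δ z
    by_cases h : 0 ≤ δ - z.1 * Real.cos θ - z.2 * Real.sin θ
    · exact mul_nonneg h (pstar_nonneg _ _ _ _)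
    · rw [pstar_support lam θ δ z h, mul_zero]
  have hl : ∫⁻ δ, ENNReal.ofReal δ ∂μ = ∫⁻ δ, ENNReal.ofReal
      (δ - (∫ z : ℝ × ℝ, z.1 * pstar lam θ δ z) * Real.cos θ
        - (∫ z : ℝ × ℝ, z.2 * pstar lam θ δ z) * Real.sin θ) ∂μ := by
    conv_lhs => rw [← hbind]
    rw [Measure.lintegral_bind (transKer_meas lam θ).aemeasurable
      ENNReal.measurable_ofReal.aemeasurable]
    congr 1; funext δ
    rw [transKer_lintegral lam θ δ _ ENNReal.measurable_ofReal, ← hmean,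
      ofReal_integral_eq_lintegral_ofReal (hint δ) (Eventually.of_forall (hnn δ))]
    congr 1; funext z
    rw [mul_comm (_ - _), ENNReal.ofReal_mul (pstar_nonneg _ _ _ _)]
  have iXc := iX.mul_const (Real.cos θ)
  have iYs := iY.mul_const (Real.sin θ)
  have hR : ∫ δ, δ ∂μ = ∫ δ, (δ - (∫ z : ℝ × ℝ, z.1 * pstar lam θ δ z) * Real.cos θ
        - (∫ z : ℝ × ℝ, z.2 * pstar lam θ δ z) * Real.sin θ) ∂μ := by
    rw [integral_eq_lintegral_of_nonneg_ae hsupp hid.aestronglyMeasurable,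
      integral_eq_lintegral_of_nonneg_ae (Eventually.of_forall fun δ => ?_)
        (int_sub_sub hid iXc iYs).aestronglyMeasurable, hl]
    rw [Pi.zero_apply, ← hmean]
    exact integral_nonneg (hnn δ)
  rw [integral_sub_sub hid iXc iYs, integral_mul_const,
    integral_mul_const] at hR
  have hY : ∫ δ, (∫ z : ℝ × ℝ, z.2 * pstar lam θ δ z) ∂μ < 0 := by
    rw [← neg_pos, ← integral_neg]
    have hp : ∀ δ, 0 < -∫ z : ℝ × ℝ, z.2 * pstar lam θ δ z := fun δ =>
      neg_pos.2 (y_neg lam hlam θ δ hs)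
    rw [integral_pos_iff_support_of_nonneg (fun δ => (hp δ).le) iY.neg]
    have : (Function.support fun δ => -∫ z : ℝ × ℝ, z.2 * pstar lam θ δ z) = Set.univ := by
      ext x; simp only [Function.mem_support, Set.mem_univ, iff_true]; exact (hp x).ne'
    rw [this]; simp
  have hYs := mul_neg_of_neg_of_pos hY hs
  refine pos_of_mul_pos_left (b := Real.cos θ) ?_ hc.le
  linarith
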